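/- arXiv:2110.11069 — 3 statements merged into one kernel-verified Lean document; each statement's English description precedes it below -/
import Mathlib

section
/- In Stipula, if two contracts C and C' are equal up to a bijective renaming of their state names, then C and C' are legally bisimilar, i.e., their initial configurations C(–, ∅, –, –), t and C'(–, ∅, –, –), t are related by the largest legal bisimulation ≃ (Theorem: Internal refactoring, states). -/
/-!
A formalization of the Stipula contract language: syntax, operational
semantics (labelled transition relation), and legal bisimulation.
-/

namespace Stipula

/-- Identifiers: names of parties, functions, states, fields, assets, contracts. -/
abbrev Ident := String

/-- Values: reals (also used as time values), strings, booleans, party addresses. -/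
inductive Value : Type where
  | num   : ℝ → Value
  | str   : String → Value
  | bool  : Bool → Value
  | party : Ident → Value

/-- Numeric content of a value, if any. -/
def Value.toNum : Value → Option ℝ
  | .num r => some r
  | _      => none

/-- Expressions (with semantic unary/binary operations). -/
inductive Expr : Type where
  | now   : Expr
  | const : Value → Expr
  | var   : Ident → Expr
  | unop  : (Value → Option Value) → Expr → Expr
  | binop : (Value → Value → Option Value) → Expr → Expr → Expr

/-- `fv E`: the set of names occurring in the expression `E`. -/
def Expr.fv : Expr → Set Ident
  | .now => ∅
  | .const _ => ∅
  | .var x => {x}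
  | .unop _ e => e.fv
  | .binop _ e₁ e₂ => e₁.fv ∪ e₂.fv

/-- Memories: maps from fields, assets and party names to values. -/
abbrev Mem := Ident → Option Value

/-- Evaluation `⟦E⟧_ℓ` of an expression in a memory. -/
def Expr.eval (ℓ : Mem) : Expr → Option Value
  | .now => none
  | .const v => some v
  | .var x => ℓ x
  | .unop f e => (e.eval ℓ).bind f
  | .binop f e₁ e₂ => (e₁.eval ℓ).bind fun v₁ => (e₂.eval ℓ).bind fun v₂ => f v₁ v₂

/-- Substitution `E[t/now]` of the current time for `now`. -/
def Expr.substNow (t : ℝ) : Expr → Expr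
  | .now => .const (.num t)
  | .const v => .const v
  | .var x => .var x
  | .unop f e => .unop f (e.substNow t)
  | .binop f e₁ e₂ => .binop f (e₁.substNow t) (e₂.substNow t)

/-- Statements (in continuation style). -/
inductive Stm : Type where
  | nil : Stm
  | valueSend : Expr → Ident → Stm → Stm          -- `E → A` ; rest
  | fieldUpd  : Expr → Ident → Stm → Stm          -- `E → x` ; rest
  | assetSend : Expr → Ident → Ident → Stm → Stm  -- `E ⊸ h,A` ; rest
  | assetUpd  : Expr → Ident → Ident → Stm → Stm  -- `E ⊸ h,h'` ; rest
  | cond : Expr → Stm → Stm → Stm                 -- `(B){ S }` ; rest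

/-- Sequential composition of statements. -/
def Stm.append : Stm → Stm → Stm
  | .nil, s => s
  | .valueSend E A k, s => .valueSend E A (k.append s)
  | .fieldUpd E x k, s => .fieldUpd E x (k.append s)
  | .assetSend E h A k, s => .assetSend E h A (k.append s)
  | .assetUpd E h h' k, s => .assetUpd E h h' (k.append s)
  | .cond B s₁ k, s => .cond B s₁ (k.append s)

/-- An event `E ≫ @Q { S } ⇒ @Q'` (time guard not yet evaluated). -/
structure Event where
  guard : Expr
  state : Ident
  body  : Stm
  next  : Ident

/-- A pending event `t ≫ @Q { S } ⇒ @Q'` whose time guard is already evaluated. -/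
structure PendingEvent where
  time  : ℝ
  state : Ident
  body  : Stm
  next  : Ident

/-- A function declaration `@Q A : f(z̄)[ȳ] (B) { S W } ⇒ @Q'`. -/
structure FunDecl where
  state : Ident
  party : Ident
  name  : Ident
  params : List Ident
  assetParams : List Ident
  pre : Expr
  body : Stm
  events : List Event
  next : Ident

/-- A Stipula contract. -/
structure Contract where
  name : Ident
  assets : List Ident
  fields : List Ident
  parties : List Ident
  agreementParts : List (List Ident × List Ident)   -- the `Āᵢ : x̄ᵢ` parts
  initState : Ident
  funs : List FunDecl

/-- A runtime contract `C(Φ, ℓ, Σ, Ψ)`. -/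
structure RtContract where
  ctr : Contract
  state : Option Ident                       -- Φ
  mem : Mem                                  -- ℓ
  res : Option (Stm × List Event × Ident)    -- Σ = `S W ⇒ @Q'` (or empty)
  pend : Multiset PendingEvent               -- Ψ

/-- Configurations: a runtime contract together with the global clock. -/
abbrev Conf := RtContract × ℝ

/-- Transition labels. -/
inductive Label : Type where
  | tau : Label                                            -- empty label
  | agree : List Ident → List (List Ident × List Value) → Label  -- (Ā, Ā₁:v̄₁,…,Āₙ:v̄ₙ)
  | call : Ident → Ident → List Value → List Value → Label -- A : f(ū)[v̄]
  | vsend : Value → Ident → Label                          -- v → A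
  | asend : Value → Ident → Label                          -- v ⊸ A

/-- Updating a memory on a list of names with a list of values. -/
def updList (ℓ : Mem) (xs : List Ident) (vs : List Value) : Mem :=
  (xs.zip vs).foldl (fun m p => Function.update m p.1 (some p.2)) ℓ

/-- The memory produced by the agreement: formal parties are bound to actual
party addresses and the agreed fields to the agreed values. -/
def agreeMem (C : Contract) (actuals : List Ident) (vals : List (List Value)) : Mem :=
  ((C.agreementParts.map Prod.snd).zip vals).foldl (fun m p => updList m p.1 p.2)
    ((C.parties.zip actuals).foldl
      (fun m p => Function.update m p.1 (some (Value.party p.2))) (fun _ => none))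

/-- Actual party address corresponding to a formal party name. -/
def actualOf (C : Contract) (actuals : List Ident) (a : Ident) : Ident :=
  ((C.parties.zip actuals).lookup a).getD a

/-- Evaluating the time guard of an event (with `now` replaced by the clock). -/
def evalEvent (ℓ : Mem) (t : ℝ) (e : Event) : Option PendingEvent :=
  (((e.guard.substNow t).eval ℓ).bind Value.toNum).map
    (fun tv => { time := tv, state := e.state, body := e.body, next := e.next })

/-- The labelled transition relation of Stipula, given by the rules Agree,
Function, State Change, Event Match, Tick, Value_Send, Asset_Send,
Field_Update, Asset_Update, Cond_true, Cond_false. -/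
inductive Step : Conf → Label → Conf → Prop where
  | agree {C : Contract} {t : ℝ} (actuals : List Ident) (vals : List (List Value))
      (hlen : actuals.length = C.parties.length)
      (hvlen : List.Forall₂
        (fun (p : List Ident × List Ident) (v : List Value) => p.2.length = v.length)
        C.agreementParts vals) :
      Step (⟨C, none, fun _ => none, none, 0⟩, t)
        (.agree actuals ((C.agreementParts.zip vals).map
          (fun pv => (pv.1.1.map (actualOf C actuals), pv.2))))
        (⟨C, some C.initState, agreeMem C actuals vals, none, 0⟩, t)
  | call {C : Contract} {Q : Ident} {ℓ : Mem} {Ψ : Multiset PendingEvent} {t : ℝ}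
      (fd : FunDecl) (args avals : List Value) (A : Ident)
      (hfd : fd ∈ C.funs) (hst : fd.state = Q)
      (hargs : args.length = fd.params.length)
      (havals : avals.length = fd.assetParams.length)
      (hA : ℓ fd.party = some (.party A))
      (hnoev : ∀ e ∈ Ψ, e.time ≠ t)
      (hpre : fd.pre.eval (updList (updList ℓ fd.params args) fd.assetParams avals)
        = some (.bool true)) :
      Step (⟨C, some Q, ℓ, none, Ψ⟩, t) (.call A fd.name args avals)
        (⟨C, some Q, updList (updList ℓ fd.params args) fd.assetParams avals,
          some (fd.body, fd.events, fd.next), Ψ⟩, t)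
  | stateChange {C : Contract} {Q : Ident} {ℓ : Mem} {W : List Event} {Q' : Ident}
      {Ψ : Multiset PendingEvent} {t : ℝ}
      (Ψ' : List PendingEvent) (hW : W.mapM (evalEvent ℓ t) = some Ψ') :
      Step (⟨C, some Q, ℓ, some (.nil, W, Q'), Ψ⟩, t) .tau
        (⟨C, some Q', ℓ, none, (↑Ψ' : Multiset PendingEvent) + Ψ⟩, t)
  | eventMatch {C : Contract} {Q : Ident} {ℓ : Mem} {Ψ' : Multiset PendingEvent} {t : ℝ}
      (e : PendingEvent) (htime : e.time = t) (hstate : e.state = Q) :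
      Step (⟨C, some Q, ℓ, none, e ::ₘ Ψ'⟩, t) .tau
        (⟨C, some Q, ℓ, some (e.body, [], e.next), Ψ'⟩, t)
  | tick {C : Contract} {Q : Ident} {ℓ : Mem} {Ψ : Multiset PendingEvent} {t : ℝ}
      (hnoev : ∀ e ∈ Ψ, e.time ≠ t) :
      Step (⟨C, some Q, ℓ, none, Ψ⟩, t) .tau (⟨C, some Q, ℓ, none, Ψ⟩, t + 1)
  | valueSend {C : Contract} {Q : Ident} {ℓ : Mem} {E : Expr} {A : Ident} {S : Stm}
      {W : List Event} {Q' : Ident} {Ψ : Multiset PendingEvent} {t : ℝ}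
      (v : Value) (a : Ident)
      (hv : E.eval ℓ = some v) (hA : ℓ A = some (.party a)) :
      Step (⟨C, some Q, ℓ, some (.valueSend E A S, W, Q'), Ψ⟩, t) (.vsend v a)
        (⟨C, some Q, ℓ, some (S, W, Q'), Ψ⟩, t)
  | assetSend {C : Contract} {Q : Ident} {ℓ : Mem} {E : Expr} {h A : Ident} {S : Stm}
      {W : List Event} {Q' : Ident} {Ψ : Multiset PendingEvent} {t : ℝ}
      (v : Value) (n m : ℝ) (a : Ident)
      (hv : E.eval ℓ = some v) (hn : v.toNum = some n)
      (hh : (ℓ h).bind Value.toNum = some m) (hge : n ≤ m)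
      (hA : ℓ A = some (.party a)) :
      Step (⟨C, some Q, ℓ, some (.assetSend E h A S, W, Q'), Ψ⟩, t) (.asend v a)
        (⟨C, some Q, Function.update ℓ h (some (.num (m - n))), some (S, W, Q'), Ψ⟩, t)
  | fieldUpd {C : Contract} {Q : Ident} {ℓ : Mem} {E : Expr} {x : Ident} {S : Stm}
      {W : List Event} {Q' : Ident} {Ψ : Multiset PendingEvent} {t : ℝ}
      (v : Value) (hv : E.eval ℓ = some v) :
      Step (⟨C, some Q, ℓ, some (.fieldUpd E x S, W, Q'), Ψ⟩, t) .tau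
        (⟨C, some Q, Function.update ℓ x (some v), some (S, W, Q'), Ψ⟩, t)
  | assetUpd {C : Contract} {Q : Ident} {ℓ : Mem} {E : Expr} {h h' : Ident} {S : Stm}
      {W : List Event} {Q' : Ident} {Ψ : Multiset PendingEvent} {t : ℝ}
      (v : Value) (n m m' : ℝ)
      (hv : E.eval ℓ = some v) (hn : v.toNum = some n)
      (hh : (ℓ h).bind Value.toNum = some m) (hge : n ≤ m)
      (hh' : (ℓ h').bind Value.toNum = some m') :
      Step (⟨C, some Q, ℓ, some (.assetUpd E h h' S, W, Q'), Ψ⟩, t) .tau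
        (⟨C, some Q,
          Function.update (Function.update ℓ h (some (.num (m - n)))) h'
            (some (.num (m' + n))),
          some (S, W, Q'), Ψ⟩, t)
  | condTrue {C : Contract} {Q : Ident} {ℓ : Mem} {B : Expr} {S₁ S₂ : Stm}
      {W : List Event} {Q' : Ident} {Ψ : Multiset PendingEvent} {t : ℝ}
      (hb : B.eval ℓ = some (.bool true)) :
      Step (⟨C, some Q, ℓ, some (.cond B S₁ S₂, W, Q'), Ψ⟩, t) .tau
        (⟨C, some Q, ℓ, some (S₁.append S₂, W, Q'), Ψ⟩, t)
  | condFalse {C : Contract} {Q : Ident} {ℓ : Mem} {B : Expr} {S₁ S₂ : Stm}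
      {W : List Event} {Q' : Ident} {Ψ : Multiset PendingEvent} {t : ℝ}
      (hb : B.eval ℓ = some (.bool false)) :
      Step (⟨C, some Q, ℓ, some (.cond B S₁ S₂, W, Q'), Ψ⟩, t) .tau
        (⟨C, some Q, ℓ, some (S₂, W, Q'), Ψ⟩, t)

/-- Silent (empty-labelled) steps. -/
def Tau (c c' : Conf) : Prop := Step c .tau c'

/-- `→*`: any number of silent steps. -/
def Taus : Conf → Conf → Prop := Relation.ReflTransGen Tau

/-- Weak transitions `⇒^μ = →* →^μ →*`. -/
def WStep (c : Conf) (μ : Label) (c' : Conf) : Prop :=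
  ∃ c₁ c₂, Taus c c₁ ∧ Step c₁ μ c₂ ∧ Taus c₂ c'

/-- Chains of weak transitions `⇒^{μ₁} ⋯ ⇒^{μₙ}`. -/
inductive WChain : Conf → List Label → Conf → Prop where
  | refl {c c' : Conf} : Taus c c' → WChain c [] c'
  | step {c c' c'' : Conf} {μ : Label} {μs : List Label} :
      WStep c μ c' → WChain c' μs c'' → WChain c (μ :: μs) c''

/-- Similarity of agreement parts: equality up to reordering of sequences. -/
def PartSim (p q : List Ident × List Value) : Prop := p.1.Perm q.1 ∧ p.2.Perm q.2

/-- `α ∼ α'`: agreement labels equal up to reordering of sequences, other labels equal. -/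
def LabelSim : Label → Label → Prop
  | .agree as ps, .agree bs qs =>
      as.Perm bs ∧ ∃ ps', ps.Perm ps' ∧ List.Forall₂ PartSim ps' qs
  | α, α' => α = α'

/-- A legal bisimulation: a symmetric relation relating configurations at equal
times satisfying the two transfer properties. -/
def IsLegalBisim (R : Conf → Conf → Prop) : Prop :=
  (∀ c d, R c d → c.2 = d.2) ∧
  (∀ c d, R c d → R d c) ∧
  (∀ c d, R c d →
    (∀ α c', WStep c α c' → c'.2 = c.2 →
      ∃ α' d', WStep d α' d' ∧ d'.2 = d.2 ∧ LabelSim α α' ∧ R c' d') ∧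
    (∀ μs c', WChain c μs c' → c'.2 = c.2 → Step c' .tau (c'.1, c'.2 + 1) →
      ∃ μs' d', μs.Perm μs' ∧ WChain d μs' d' ∧ d'.2 = d.2 ∧
        Step d' .tau (d'.1, d'.2 + 1) ∧ R (c'.1, c'.2 + 1) (d'.1, d'.2 + 1)))

/-- Bisimilarity `≃`: the largest legal bisimulation (the union of them all). -/
def Bisim (c d : Conf) : Prop := ∃ R, IsLegalBisim R ∧ R c d

/-- The initial runtime contract `C(–, ∅, –, –)`. -/
def initRt (C : Contract) : RtContract :=
  { ctr := C, state := none, mem := fun _ => none, res := none, pend := 0 }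

/-- `C ≃ C'`: the initial configurations are bisimilar. -/
def ContractBisim (C C' : Contract) : Prop :=
  ∀ t : ℝ, Bisim (initRt C, t) (initRt C', t)

end Stipula
namespace Stipula

/-! ### Renamings -/

/-- Renaming the state names of an event. -/
def Event.renameStates (σ : Ident → Ident) (e : Event) : Event :=
  { e with state := σ e.state, next := σ e.next }

/-- Renaming the state names of a function declaration. -/
def FunDecl.renameStates (σ : Ident → Ident) (f : FunDecl) : FunDecl :=
  { f with state := σ f.state, next := σ f.next,
           events := f.events.map (Event.renameStates σ) }

/-- Renaming the state names of a contract. -/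
def Contract.renameStates (σ : Ident → Ident) (C : Contract) : Contract :=
  { C with initState := σ C.initState, funs := C.funs.map (FunDecl.renameStates σ) }

/-- Renaming the value names (fields, assets, parties, parameters) in an expression. -/
def Expr.renameVars (σ : Ident → Ident) : Expr → Expr
  | .now => .now
  | .const v => .const v
  | .var x => .var (σ x)
  | .unop f e => .unop f (e.renameVars σ)
  | .binop f e₁ e₂ => .binop f (e₁.renameVars σ) (e₂.renameVars σ)

/-- Renaming the value names in a statement. -/
def Stm.renameVars (σ : Ident → Ident) : Stm → Stm
  | .nil => .nil
  | .valueSend E A k => .valueSend (E.renameVars σ) (σ A) (k.renameVars σ)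
  | .fieldUpd E x k => .fieldUpd (E.renameVars σ) (σ x) (k.renameVars σ)
  | .assetSend E h A k => .assetSend (E.renameVars σ) (σ h) (σ A) (k.renameVars σ)
  | .assetUpd E h h' k => .assetUpd (E.renameVars σ) (σ h) (σ h') (k.renameVars σ)
  | .cond B s₁ k => .cond (B.renameVars σ) (s₁.renameVars σ) (k.renameVars σ)

/-- Renaming the value names in an event. -/
def Event.renameVars (σ : Ident → Ident) (e : Event) : Event :=
  { e with guard := e.guard.renameVars σ, body := e.body.renameVars σ }

/-- Renaming the value names in a function declaration. -/
def FunDecl.renameVars (σ : Ident → Ident) (f : FunDecl) : FunDecl :=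
  { f with party := σ f.party, params := f.params.map σ,
           assetParams := f.assetParams.map σ,
           pre := f.pre.renameVars σ, body := f.body.renameVars σ,
           events := f.events.map (Event.renameVars σ) }

/-- Renaming the value names (assets, fields, parties) of a contract. -/
def Contract.renameVars (σ : Ident → Ident) (C : Contract) : Contract :=
  { C with assets := C.assets.map σ, fields := C.fields.map σ,
           parties := C.parties.map σ,
           agreementParts := C.agreementParts.map (fun p => (p.1.map σ, p.2.map σ)),
           funs := C.funs.map (FunDecl.renameVars σ) }

/-! ### One-hole statement contexts and contract contexts -/

/-- One-hole contexts for statements. -/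
inductive SCtx : Type where
  | hole : Stm → SCtx                              -- the hole, followed by a continuation
  | valueSend : Expr → Ident → SCtx → SCtx
  | fieldUpd  : Expr → Ident → SCtx → SCtx
  | assetSend : Expr → Ident → Ident → SCtx → SCtx
  | assetUpd  : Expr → Ident → Ident → SCtx → SCtx
  | condL : Expr → SCtx → Stm → SCtx               -- hole inside the branch
  | condR : Expr → Stm → SCtx → SCtx               -- hole in the continuation

/-- Plugging a statement into a one-hole statement context. -/
def SCtx.plug : SCtx → Stm → Stm
  | .hole k, s => s.append k
  | .valueSend E A c, s => .valueSend E A (c.plug s)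
  | .fieldUpd E x c, s => .fieldUpd E x (c.plug s)
  | .assetSend E h A c, s => .assetSend E h A (c.plug s)
  | .assetUpd E h h' c, s => .assetUpd E h h' (c.plug s)
  | .condL B c k, s => .cond B (c.plug s) k
  | .condR B s₁ c, s => .cond B s₁ (c.plug s)

/-- An event with a hole in its handler. -/
structure EventCtx where
  guard : Expr
  state : Ident
  body  : SCtx
  next  : Ident

def EventCtx.plug (e : EventCtx) (s : Stm) : Event :=
  ⟨e.guard, e.state, e.body.plug s, e.next⟩

/-- The position of the hole inside a function declaration: either in the
statement part of the body or inside one of the event handlers. -/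
inductive FunHole : Type where
  | inBody : SCtx → List Event → FunHole
  | inEvent : Stm → List Event → EventCtx → List Event → FunHole

def FunHole.plug : FunHole → Stm → Stm × List Event
  | .inBody c evs, s => (c.plug s, evs)
  | .inEvent b pre ec post, s => (b, pre ++ [ec.plug s] ++ post)

/-- A function declaration with a hole. -/
structure FunDeclCtx where
  state : Ident
  party : Ident
  name  : Ident
  params : List Ident
  assetParams : List Ident
  pre : Expr
  hole : FunHole
  next : Ident

def FunDeclCtx.plug (f : FunDeclCtx) (s : Stm) : FunDecl :=
  ⟨f.state, f.party, f.name, f.params, f.assetParams, f.pre,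
   (f.hole.plug s).1, (f.hole.plug s).2, f.next⟩

/-- A contract context `C[·]`: a contract containing a hole where a statement
may occur. -/
structure ContractCtx where
  name : Ident
  assets : List Ident
  fields : List Ident
  parties : List Ident
  agreementParts : List (List Ident × List Ident)
  initState : Ident
  funsPre : List FunDecl
  holeFun : FunDeclCtx
  funsPost : List FunDecl

/-- Plugging a statement into a contract context: `C[S]`. -/
def ContractCtx.plug (K : ContractCtx) (s : Stm) : Contract :=
  ⟨K.name, K.assets, K.fields, K.parties, K.agreementParts, K.initState,
   K.funsPre ++ [K.holeFun.plug s] ++ K.funsPost⟩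

/-- `S ≃ S'` for statements: `C[S] ≃ C[S']` for every contract context. -/
def StmBisim (S S' : Stm) : Prop :=
  ∀ K : ContractCtx, ContractBisim (K.plug S) (K.plug S')

/-! ### Pending-event contexts (for the witness relation of Theorem 3) -/

/-- An item of a pending-event context: either an ordinary pending event or a
pending event whose handler contains the hole. -/
inductive PEItem : Type where
  | ev : PendingEvent → PEItem
  | ctx : ℝ → Ident → SCtx → Ident → PEItem

def PEItem.plug : PEItem → Stm → PendingEvent
  | .ev e, _ => e
  | .ctx t q c q', s => ⟨t, q, c.plug s, q'⟩

/-- A pending-event context `Ψ[·]`: a multiset of pending events in which the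
plugged statement occurs inside some of the handlers. -/
def PendCtx : Type := Multiset PEItem

def PendCtx.plug (Ψ : PendCtx) (s : Stm) : Multiset PendingEvent :=
  Multiset.map (fun i => i.plug s) Ψ

end Stipula

namespace Stipula
/-- Renaming the state names of a pending event. -/
def PendingEvent.renameStates (σ : Ident → Ident) (e : PendingEvent) : PendingEvent :=
  { e with state := σ e.state, next := σ e.next }

/-- Renaming the state names of a runtime contract. -/
def RtContract.renameStates (σ : Ident → Ident) (c : RtContract) : RtContract :=
  { ctr := c.ctr.renameStates σ
    state := c.state.map σ
    mem := c.mem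
    res := c.res.map fun r => (r.1, r.2.1.map (Event.renameStates σ), σ r.2.2)
    pend := c.pend.map (PendingEvent.renameStates σ) }

/-- Renaming the state names of a configuration. -/
def Conf.renameStates (σ : Ident → Ident) (c : Conf) : Conf :=
  (c.1.renameStates σ, c.2)

theorem Contract.renameStates_leftInverse {σ τ : Ident → Ident} (h : Function.LeftInverse τ σ) :
    Function.LeftInverse (Contract.renameStates τ) (Contract.renameStates σ) := by
  have hev : Function.LeftInverse (Event.renameStates τ) (Event.renameStates σ) := fun e => by
    simp [Event.renameStates, h _]
  have hfd : Function.LeftInverse (FunDecl.renameStates τ) (FunDecl.renameStates σ) := fun f => by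
    simp [FunDecl.renameStates, h _, hev.comp_eq_id]
  intro C
  simp [Contract.renameStates, h _, hfd.comp_eq_id]

theorem Conf.renameStates_leftInverse {σ τ : Ident → Ident} (h : Function.LeftInverse τ σ) :
    Function.LeftInverse (Conf.renameStates τ) (Conf.renameStates σ) := by
  have hev : Function.LeftInverse (Event.renameStates τ) (Event.renameStates σ) := fun e => by
    simp [Event.renameStates, h _]
  have hpe : Function.LeftInverse (PendingEvent.renameStates τ) (PendingEvent.renameStates σ) :=
    fun e => by simp [PendingEvent.renameStates, h _]
  rintro ⟨⟨C, Q, ℓ, r, Ψ⟩, t⟩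
  cases Q <;> cases r <;>
    simp [Conf.renameStates, RtContract.renameStates, Contract.renameStates_leftInverse h _,
      h _, hev.comp_eq_id, funext hpe]

theorem evalEvent_renameStates (σ : Ident → Ident) (ℓ : Mem) (t : ℝ) (e : Event) :
    evalEvent ℓ t (e.renameStates σ) = (evalEvent ℓ t e).map (PendingEvent.renameStates σ) := by
  simp [evalEvent, Event.renameStates, PendingEvent.renameStates, Function.comp_def]

theorem mapM_evalEvent_renameStates (σ : Ident → Ident) (ℓ : Mem) (t : ℝ) {W : List Event}
    {Ψ : List PendingEvent} (h : W.mapM (evalEvent ℓ t) = some Ψ) :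
    (W.map (Event.renameStates σ)).mapM (evalEvent ℓ t) =
      some (Ψ.map (PendingEvent.renameStates σ)) := by
  induction W generalizing Ψ with
  | nil => simp_all
  | cons e W ih =>
    simp only [List.mapM_cons, Option.bind_eq_bind, Option.bind_eq_some_iff, Option.pure_def,
      Option.some.injEq] at h
    obtain ⟨p, hp, Ψ', hΨ', rfl⟩ := h
    simp [evalEvent_renameStates, hp, ih hΨ']

theorem PendingEvent.time_ne_of_mem_map_renameStates (σ : Ident → Ident)
    {Ψ : Multiset PendingEvent} {t : ℝ} (h : ∀ e ∈ Ψ, e.time ≠ t) :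
    ∀ e ∈ Ψ.map (PendingEvent.renameStates σ), e.time ≠ t := by
  intro e he
  obtain ⟨p, hp, rfl⟩ := Multiset.mem_map.1 he
  exact h p hp

/-- Transitions are preserved by every renaming of the state names. -/
theorem Step.renameStates (σ : Ident → Ident) {c c' : Conf} {μ : Label} (h : Step c μ c') :
    Step (Conf.renameStates σ c) μ (Conf.renameStates σ c') := by
  cases h with
  | agree actuals vals hlen hvlen =>
    exact Step.agree (C := Contract.renameStates σ _) actuals vals hlen hvlen
  | call fd args avals A hfd hst hargs havals hA hnoev hpre =>
    exact Step.call (C := Contract.renameStates σ _) (fd.renameStates σ) args avals A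
      (List.mem_map_of_mem hfd) (congrArg σ hst) hargs havals hA
      (PendingEvent.time_ne_of_mem_map_renameStates σ hnoev) hpre
  | @stateChange C Q ℓ W Q' Ψ t Ψ' hW =>
    have := Step.stateChange (C := C.renameStates σ) (Q := σ Q) (Q' := σ Q')
      (Ψ := Ψ.map (PendingEvent.renameStates σ)) _ (mapM_evalEvent_renameStates σ ℓ t hW)
    simpa [Conf.renameStates, RtContract.renameStates] using this
  | @eventMatch C Q ℓ Ψ t e htime hstate =>
    have := Step.eventMatch (C := C.renameStates σ) (Q := σ Q) (ℓ := ℓ)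
      (Ψ' := Ψ.map (PendingEvent.renameStates σ)) (e.renameStates σ) htime
      (congrArg σ hstate)
    simpa [Conf.renameStates, RtContract.renameStates, PendingEvent.renameStates] using this
  | tick hnoev => exact Step.tick (PendingEvent.time_ne_of_mem_map_renameStates σ hnoev)
  | valueSend v a hv hA => exact Step.valueSend v a hv hA
  | assetSend v n m a hv hn hh hge hA => exact Step.assetSend v n m a hv hn hh hge hA
  | fieldUpd v hv => exact Step.fieldUpd v hv
  | assetUpd v n m m' hv hn hh hge hh' => exact Step.assetUpd v n m m' hv hn hh hge hh'
  | condTrue hb => exact Step.condTrue hb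
  | condFalse hb => exact Step.condFalse hb

theorem Taus.renameStates (σ : Ident → Ident) {c c' : Conf} (h : Taus c c') :
    Taus (Conf.renameStates σ c) (Conf.renameStates σ c') :=
  Relation.ReflTransGen.lift (Conf.renameStates σ) (fun _ _ => Step.renameStates σ) _ _ h

theorem WStep.renameStates (σ : Ident → Ident) {c c' : Conf} {μ : Label} (h : WStep c μ c') :
    WStep (Conf.renameStates σ c) μ (Conf.renameStates σ c') := by
  obtain ⟨c₁, c₂, h₁, h₂, h₃⟩ := h
  exact ⟨_, _, h₁.renameStates σ, h₂.renameStates σ, h₃.renameStates σ⟩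

theorem WChain.renameStates (σ : Ident → Ident) {c c' : Conf} {μs : List Label}
    (h : WChain c μs c') : WChain (Conf.renameStates σ c) μs (Conf.renameStates σ c') := by
  induction h with
  | refl h => exact .refl (h.renameStates σ)
  | step h _ ih => exact .step (h.renameStates σ) ih

theorem PartSim.refl (p : List Ident × List Value) : PartSim p p :=
  ⟨.refl _, .refl _⟩

theorem LabelSim.refl (α : Label) : LabelSim α α := by
  cases α with
  | agree as ps => exact ⟨.refl _, ps, .refl _, List.forall₂_same.2 fun p _ => PartSim.refl p⟩
  | _ => rfl

/-- Equality of configurations up to a bijective renaming of the state names is a legal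
bisimulation. -/
theorem isLegalBisim_renameStates :
    IsLegalBisim fun c d => ∃ σ, Function.Bijective σ ∧ d = Conf.renameStates σ c := by
  refine ⟨?_, ?_, ?_⟩
  · rintro c _ ⟨σ, -, rfl⟩
    rfl
  · rintro c _ ⟨σ, hσ, rfl⟩
    obtain ⟨τ, hl, hr⟩ := Function.bijective_iff_has_inverse.1 hσ
    exact ⟨τ, ⟨hr.injective, hl.surjective⟩, (Conf.renameStates_leftInverse hl c).symm⟩
  · rintro c _ ⟨σ, hσ, rfl⟩
    refine ⟨fun α c' h ht => ?_, fun μs c' h ht htick => ?_⟩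
    · exact ⟨α, _, h.renameStates σ, ht, .refl α, σ, hσ, rfl⟩
    · exact ⟨μs, _, .refl _, h.renameStates σ, ht, htick.renameStates σ, σ, hσ, rfl⟩

/-- **Internal refactoring (states).** If two contracts are equal up to a
bijective renaming of their state names, then they are legally bisimilar. -/
theorem internal_refactoring_states (C C' : Contract) (σ : Ident → Ident)
    (hσ : Function.Bijective σ) (hC' : C' = C.renameStates σ) :
    ContractBisim C C' := by
  subst hC'
  exact fun t => ⟨_, isLegalBisim_renameStates, σ, hσ, rfl⟩

end Stipula
end

section
/- In Stipula, if two contracts C and C' are equal up to a bijective renaming of contract names, then C ≃ C', i.e., their initial configurations are related by the largest legal bisimulation (Theorem: Internal refactoring, contract names). -/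
namespace Stipula
/-- The configuration whose contract is renamed to `n`. -/
def setName (n : Ident) (c : Conf) : Conf :=
  ({ c.1 with ctr := { c.1.ctr with name := n } }, c.2)

theorem Step.setName (n : Ident) {c c' : Conf} {μ : Label} (h : Step c μ c') :
    Step (setName n c) μ (setName n c') := by
  cases h with
  | @agree C t actuals vals hlen hvlen =>
    exact Step.agree (C := { C with name := n }) actuals vals hlen hvlen
  | call fd args avals A hfd hst hargs havals hA hnoev hpre =>
    exact Step.call fd args avals A hfd hst hargs havals hA hnoev hpre
  | stateChange Ψ' hW => exact Step.stateChange Ψ' hW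
  | eventMatch e htime hstate => exact Step.eventMatch e htime hstate
  | tick hnoev => exact Step.tick hnoev
  | valueSend v a hv hA => exact Step.valueSend v a hv hA
  | assetSend v k m a hv hn hh hge hA => exact Step.assetSend v k m a hv hn hh hge hA
  | fieldUpd v hv => exact Step.fieldUpd v hv
  | assetUpd v k m m' hv hn hh hge hh' => exact Step.assetUpd v k m m' hv hn hh hge hh'
  | condTrue hb => exact Step.condTrue hb
  | condFalse hb => exact Step.condFalse hb

theorem Taus.setName (n : Ident) {c c' : Conf} (h : Taus c c') :
    Taus (setName n c) (setName n c') := by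
  induction h with
  | refl => exact .refl
  | tail _ hs ih => exact .tail ih (Step.setName n hs)

theorem WStep.setName (n : Ident) {c c' : Conf} {μ : Label} (h : WStep c μ c') :
    WStep (setName n c) μ (setName n c') := by
  obtain ⟨c₁, c₂, h₁, h₂, h₃⟩ := h
  exact ⟨_, _, Taus.setName n h₁, h₂.setName n, Taus.setName n h₃⟩

theorem WChain.setName (n : Ident) {c c' : Conf} {μs : List Label} (h : WChain c μs c') :
    WChain (setName n c) μs (setName n c') := by
  induction h with
  | refl h => exact .refl (Taus.setName n h)
  | step h _ ih => exact .step (WStep.setName n h) ih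

/-- Having equal configurations up to the contract name is a legal bisimulation. -/
theorem isLegalBisim_setName : IsLegalBisim fun c d => ∃ n, d = setName n c := by
  refine ⟨?_, ?_, ?_⟩
  · rintro c _ ⟨n, rfl⟩
    rfl
  · rintro c _ ⟨n, rfl⟩
    exact ⟨c.1.ctr.name, rfl⟩
  · rintro c _ ⟨n, rfl⟩
    refine ⟨fun α c' h ht => ?_, fun μs c' h ht htick => ?_⟩
    · exact ⟨α, setName n c', h.setName n, ht, .refl α, n, rfl⟩
    · exact ⟨μs, setName n c', .refl _, h.setName n, ht, htick.setName n, n, rfl⟩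

/-- **Internal refactoring (contract names).** If two contracts are equal up
to a bijective renaming of contract names, then they are legally bisimilar. -/
theorem internal_refactoring_contract_names (C C' : Contract) (σ : Ident → Ident)
    (hσ : Function.Bijective σ) (hC' : C' = { C with name := σ C.name }) :
    ContractBisim C C' := by
  subst hC'
  exact fun _ => ⟨_, isLegalBisim_setName, σ C.name, rfl⟩

end Stipula
end

section
/- Expired pending events can be garbage-collected up to legal bisimilarity: if t < t', then the runtime configuration C(Q, ℓ, Σ, Ψ | t ≫ @Q { S } ⇒ @Q'), t' is legally bisimilar to C(Q, ℓ, Σ, Ψ), t', i.e., removing from the multiset of pending events an event whose time guard t is strictly earlier than the current clock t' yields a bisimilar configuration (Theorem: Time shift, part 2). -/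
namespace Stipula

/-- Strong simulations for the labelled transition relation. -/
def IsSim (P : Conf → Conf → Prop) : Prop :=
  ∀ ⦃c d μ c'⦄, P c d → Step c μ c' → ∃ d', Step d μ d' ∧ P c' d'

theorem IsSim.taus {P : Conf → Conf → Prop} (hP : IsSim P) {c d c' : Conf}
    (h : P c d) (hc : Taus c c') : ∃ d', Taus d d' ∧ P c' d' := by
  induction hc with
  | refl => exact ⟨d, .refl, h⟩
  | tail _ hs ih =>
    obtain ⟨d₁, hd₁, h₁⟩ := ih
    obtain ⟨d₂, hd₂, h₂⟩ := hP h₁ hs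
    exact ⟨d₂, .tail hd₁ hd₂, h₂⟩

theorem IsSim.wStep {P : Conf → Conf → Prop} (hP : IsSim P) {c d c' : Conf} {μ : Label}
    (h : P c d) (hc : WStep c μ c') : ∃ d', WStep d μ d' ∧ P c' d' := by
  obtain ⟨c₁, c₂, hc₁, hs, hc₂⟩ := hc
  obtain ⟨d₁, hd₁, h₁⟩ := hP.taus h hc₁
  obtain ⟨d₂, hd₂, h₂⟩ := hP h₁ hs
  obtain ⟨d₃, hd₃, h₃⟩ := hP.taus h₂ hc₂
  exact ⟨d₃, ⟨d₁, d₂, hd₁, hd₂, hd₃⟩, h₃⟩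

theorem IsSim.wChain {P : Conf → Conf → Prop} (hP : IsSim P) {c d c' : Conf} {μs : List Label}
    (h : P c d) (hc : WChain c μs c') : ∃ d', WChain d μs d' ∧ P c' d' := by
  induction hc generalizing d with
  | refl ht =>
    obtain ⟨d', hd, h'⟩ := hP.taus h ht
    exact ⟨d', .refl hd, h'⟩
  | step hw _ ih =>
    obtain ⟨d₁, hd₁, h₁⟩ := hP.wStep h hw
    obtain ⟨d₂, hd₂, h₂⟩ := ih h₁
    exact ⟨d₂, .step hd₁ hd₂, h₂⟩

/-- The configuration `c` with the additional pending event `e`. -/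
def addPending (e : PendingEvent) (c : Conf) : Conf :=
  ({ c.1 with pend := e ::ₘ c.1.pend }, c.2)

/-- `Expired e c`: the contract of `c` is running and the time guard of `e` is in the past. -/
def Expired (e : PendingEvent) (c : Conf) : Prop :=
  c.1.state ≠ none ∧ e.time < c.2

theorem addPending_injective (e : PendingEvent) : Function.Injective (addPending e) := by
  rintro ⟨⟨_, _, _, _, _⟩, _⟩ ⟨⟨_, _, _, _, _⟩, _⟩ h
  simpa [addPending] using h

theorem Step.expired {e : PendingEvent} {c c' : Conf} {μ : Label} (h : Step c μ c')
    (he : Expired e c) : Expired e c' := by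
  obtain ⟨hs, ht⟩ := he
  cases h with
  | agree => exact absurd rfl hs
  | tick => exact ⟨by simp, ht.trans (lt_add_one _)⟩
  | _ => exact ⟨by simp, ht⟩

theorem Step.addPending {e : PendingEvent} {c c' : Conf} {μ : Label} (h : Step c μ c')
    (he : Expired e c) : Step (addPending e c) μ (addPending e c') := by
  obtain ⟨hs, ht⟩ := he
  cases h with
  | agree => exact absurd rfl hs
  | call fd args avals A hfd hst hargs havals hA hnoev hpre =>
    exact .call fd args avals A hfd hst hargs havals hA
      (Multiset.forall_mem_cons.2 ⟨ht.ne, hnoev⟩) hpre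
  | stateChange Ψ' hW =>
    simp only [Stipula.addPending, ← Multiset.add_cons]
    exact .stateChange Ψ' hW
  | eventMatch e' htime hstate =>
    dsimp only [Stipula.addPending]
    rw [Multiset.cons_swap]
    exact .eventMatch e' htime hstate
  | tick hnoev => exact .tick (Multiset.forall_mem_cons.2 ⟨ht.ne, hnoev⟩)
  | valueSend v a hv hA => exact .valueSend v a hv hA
  | assetSend v n m a hv hn hh hge hA => exact .assetSend v n m a hv hn hh hge hA
  | fieldUpd v hv => exact .fieldUpd v hv
  | assetUpd v n m m' hv hn hh hge hh' => exact .assetUpd v n m m' hv hn hh hge hh'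
  | condTrue hb => exact .condTrue hb
  | condFalse hb => exact .condFalse hb

theorem Step.of_addPending {e : PendingEvent} {c x : Conf} {μ : Label}
    (h : Step (Stipula.addPending e c) μ x) (he : Expired e c) :
    ∃ c', x = Stipula.addPending e c' ∧ Step c μ c' := by
  obtain ⟨⟨C, st, ℓ, res, Ψ⟩, t⟩ := c
  obtain ⟨hs, ht⟩ := he
  dsimp only [Stipula.addPending] at h hs ht
  generalize hΦ : e ::ₘ Ψ = Φ at h
  cases h with
  | agree => exact absurd rfl hs
  | call fd args avals A hfd hst hargs havals hA hnoev hpre =>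
    subst hΦ
    exact ⟨_, rfl, .call fd args avals A hfd hst hargs havals hA
      (Multiset.forall_mem_cons.1 hnoev).2 hpre⟩
  | stateChange Ψ' hW =>
    subst hΦ
    exact ⟨_, by simp only [Stipula.addPending, Multiset.add_cons], .stateChange Ψ' hW⟩
  | eventMatch e' htime hstate =>
    obtain ⟨rfl, -⟩ | ⟨-, Ψ₀, rfl, rfl⟩ := Multiset.cons_eq_cons.1 hΦ
    · exact absurd htime ht.ne
    · exact ⟨_, rfl, .eventMatch e' htime hstate⟩
  | tick hnoev =>
    subst hΦ
    exact ⟨_, rfl, .tick (Multiset.forall_mem_cons.1 hnoev).2⟩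
  | valueSend v a hv hA => subst hΦ; exact ⟨_, rfl, .valueSend v a hv hA⟩
  | assetSend v n m a hv hn hh hge hA =>
    subst hΦ; exact ⟨_, rfl, .assetSend v n m a hv hn hh hge hA⟩
  | fieldUpd v hv => subst hΦ; exact ⟨_, rfl, .fieldUpd v hv⟩
  | assetUpd v n m m' hv hn hh hge hh' =>
    subst hΦ; exact ⟨_, rfl, .assetUpd v n m m' hv hn hh hge hh'⟩
  | condTrue hb => subst hΦ; exact ⟨_, rfl, .condTrue hb⟩
  | condFalse hb => subst hΦ; exact ⟨_, rfl, .condFalse hb⟩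

/-- The two configurations differ by the expired pending event `e`, in either direction. -/
def DiffExpired (e : PendingEvent) (c d : Conf) : Prop :=
  (c = addPending e d ∧ Expired e d) ∨ (d = addPending e c ∧ Expired e c)

theorem DiffExpired.time_eq {e : PendingEvent} {c d : Conf} (h : DiffExpired e c d) :
    c.2 = d.2 := by
  obtain ⟨rfl, -⟩ | ⟨rfl, -⟩ := h <;> rfl

theorem isSim_diffExpired (e : PendingEvent) : IsSim (DiffExpired e) := by
  rintro c d μ c' (⟨rfl, he⟩ | ⟨rfl, he⟩) hs
  · obtain ⟨d', rfl, hd⟩ := hs.of_addPending he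
    exact ⟨d', hd, .inl ⟨rfl, hd.expired he⟩⟩
  · exact ⟨_, hs.addPending he, .inr ⟨rfl, hs.expired he⟩⟩

theorem DiffExpired.tick {e : PendingEvent} {c d : Conf} (h : DiffExpired e c d)
    (hs : Step c .tau (c.1, c.2 + 1)) :
    Step d .tau (d.1, d.2 + 1) ∧ DiffExpired e (c.1, c.2 + 1) (d.1, d.2 + 1) := by
  obtain ⟨rfl, he⟩ | ⟨rfl, he⟩ := h
  · obtain ⟨d', hd, hs'⟩ := hs.of_addPending he
    obtain rfl : (d.1, d.2 + 1) = d' := addPending_injective e hd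
    exact ⟨hs', .inl ⟨rfl, hs'.expired he⟩⟩
  · exact ⟨hs.addPending he, .inr ⟨rfl, hs.expired he⟩⟩

theorem isLegalBisim_diffExpired (e : PendingEvent) : IsLegalBisim (DiffExpired e) := by
  refine ⟨fun _ _ h => h.time_eq, fun _ _ h => h.symm, fun c d h => ⟨?_, ?_⟩⟩
  · intro α c' hw ht
    obtain ⟨d', hd, h'⟩ := (isSim_diffExpired e).wStep h hw
    exact ⟨α, d', hd, by rw [← h'.time_eq, ht, h.time_eq], .refl α, h'⟩
  · intro μs c' hw ht hs
    obtain ⟨d', hd, h'⟩ := (isSim_diffExpired e).wChain h hw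
    obtain ⟨hs', h''⟩ := h'.tick hs
    exact ⟨μs, d', .refl _, hd, by rw [← h'.time_eq, ht, h.time_eq], hs', h''⟩

/-- **Time shift, part 2.** Expired pending events can be garbage-collected up
to legal bisimilarity: if `t < t'` then
`C(Q, ℓ, Σ, Ψ | t ≫ @Q { S } ⇒ @Q'), t' ≃ C(Q, ℓ, Σ, Ψ), t'`. -/
theorem time_shift_gc (C : Contract) (Q : Ident) (ℓ : Mem)
    (res : Option (Stm × List Event × Ident)) (Ψ : Multiset PendingEvent)
    (S : Stm) (Q' : Ident) (t t' : ℝ) (hlt : t < t') :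
    Bisim (⟨C, some Q, ℓ, res, (⟨t, Q, S, Q'⟩ : PendingEvent) ::ₘ Ψ⟩, t')
          (⟨C, some Q, ℓ, res, Ψ⟩, t') :=
  ⟨DiffExpired ⟨t, Q, S, Q'⟩, isLegalBisim_diffExpired _, .inl ⟨rfl, by simp, hlt⟩⟩

end Stipula
end
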